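/- Under the hypotheses of Theorem 1 (A(u) = C⁻¹ diag(a_1(u),…,a_n(u)) C with C orthogonal and a_j(u) > 0 μ-measurable, u ↦ |Φ(u)|(a_1(u)⋯a_n(u))^{-1/2} μ-integrable, T a continuous linear operator on L²(ℝⁿ;ℂ) realizing H_{Φ,A} with symbol φ): (a) T is self-adjoint if and only if φ(s) ∈ ℝ for all s ∈ ℝⁿ; (b) T is a positive operator if and only if φ(s) ≥ 0 for all s ∈ ℝⁿ; (c) T is unitary if and only if |φ(s)| = 1 for all s ∈ ℝⁿ. -/

import Mathlib

open MeasureTheory Complex Filter Matrix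
open scoped ENNReal ComplexConjugate

section MulOperator

variable {α F : Type*} [MeasurableSpace α] {ν : Measure α}
  [NormedAddCommGroup F] [InnerProductSpace ℂ F]

/-- Multiplication by an essentially bounded function, as an operator on `L²`. -/
noncomputable def mulLp (F : Type*) [NormedAddCommGroup F] [InnerProductSpace ℂ F]
    {b : α → ℂ} (hb : MemLp b ∞ ν) : Lp F 2 ν →L[ℂ] Lp F 2 ν :=
  (ContinuousLinearMap.lsmul ℂ ℂ).holderL ν ∞ 2 2 (hb.toLp b)

theorem coeFn_mulLp {b : α → ℂ} (hb : MemLp b ∞ ν) (f : Lp F 2 ν) :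
    mulLp F hb f =ᵐ[ν] fun x => b x • f x := by
  have h := (ContinuousLinearMap.lsmul ℂ ℂ).coeFn_holder (r := 2) (hb.toLp b) f
  filter_upwards [h, hb.coeFn_toLp] with x hx hx'
  rw [← hx']
  exact hx

theorem inner_mulLp {b : α → ℂ} (hb : MemLp b ∞ ν) (f g : Lp F 2 ν) :
    inner ℂ g (mulLp F hb f) = ∫ x, b x * inner ℂ (g x) (f x) ∂ν := by
  rw [L2.inner_def]
  refine integral_congr_ae ?_
  filter_upwards [coeFn_mulLp hb f] with x hx
  rw [hx, inner_smul_right]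

theorem adjoint_mulLp [CompleteSpace F] {b : α → ℂ} (hb : MemLp b ∞ ν) :
    star (mulLp F hb) = mulLp F hb.star := by
  rw [ContinuousLinearMap.star_eq_adjoint, eq_comm, ContinuousLinearMap.eq_adjoint_iff]
  intro f g
  rw [inner_mulLp, ← inner_conj_symm, inner_mulLp, ← integral_conj]
  refine integral_congr_ae (.of_forall fun x => ?_)
  simp

theorem mulLp_mul {b c : α → ℂ} (hb : MemLp b ∞ ν) (hc : MemLp c ∞ ν)
    (hbc : MemLp (b * c) ∞ ν) : mulLp F hb * mulLp F hc = mulLp F hbc := by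
  ext1 f
  refine Lp.ext ?_
  filter_upwards [coeFn_mulLp hb (mulLp F hc f), coeFn_mulLp hc f, coeFn_mulLp hbc f]
    with x h1 h2 h3
  rw [h3, mul_apply_eq_comp, h1, h2, smul_smul, Pi.mul_apply]

theorem mulLp_eq_iff [SigmaFinite ν] [Nontrivial F] {b c : α → ℂ} (hb : MemLp b ∞ ν)
    (hc : MemLp c ∞ ν) : mulLp F hb = mulLp F hc ↔ b =ᵐ[ν] c := by
  constructor
  · intro h
    obtain ⟨v, hv⟩ := exists_ne (0 : F)
    have key : ∀ n, ∀ᵐ x ∂ν, x ∈ spanningSets ν n → b x = c x := by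
      intro n
      set w : Lp F 2 ν := indicatorConstLp 2 (measurableSet_spanningSets ν n)
        (measure_spanningSets_lt_top ν n).ne v
      filter_upwards [coeFn_mulLp hb w, coeFn_mulLp hc w,
        indicatorConstLp_coeFn (p := 2) (hs := measurableSet_spanningSets ν n)
          (hμs := (measure_spanningSets_lt_top ν n).ne) (c := v)] with x h1 h2 h3 hx
      rw [h, h2] at h1
      change w x = _ at h3
      rw [h3, Set.indicator_of_mem hx] at h1
      exact (smul_left_injective ℂ hv h1).symm
    filter_upwards [ae_all_iff.2 key] with x hx
    have : x ∈ ⋃ n, spanningSets ν n := by simp [iUnion_spanningSets]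
    obtain ⟨n, hn⟩ := Set.mem_iUnion.1 this
    exact hx n hn
  · intro h
    ext1 f
    refine Lp.ext ?_
    filter_upwards [coeFn_mulLp hb f, coeFn_mulLp hc f, h] with x h1 h2 h3
    rw [h1, h2, h3]

theorem mulLp_one (h1 : MemLp (1 : α → ℂ) ∞ ν) : mulLp F h1 = 1 := by
  ext1 f
  refine Lp.ext ?_
  filter_upwards [coeFn_mulLp h1 f] with x h1
  simp [h1]

theorem isSelfAdjoint_mulLp_iff [CompleteSpace F] [SigmaFinite ν] [Nontrivial F] {b : α → ℂ}
    (hb : MemLp b ∞ ν) : IsSelfAdjoint (mulLp F hb) ↔ ∀ᵐ x ∂ν, (b x).im = 0 := by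
  rw [isSelfAdjoint_iff, adjoint_mulLp, mulLp_eq_iff]
  refine eventually_congr (.of_forall fun x => ?_)
  rw [Pi.star_apply, ← Complex.conj_eq_iff_im]
  rfl

theorem isPositive_mulLp_iff [CompleteSpace F] [SigmaFinite ν] [Nontrivial F] {b : α → ℂ}
    (hb : MemLp b ∞ ν) :
    (mulLp F hb).IsPositive ↔ ∀ᵐ x ∂ν, 0 ≤ (b x).re ∧ (b x).im = 0 := by
  have hint : ∀ f : Lp F 2 ν, Integrable (fun x => b x * inner ℂ (f x) (f x)) ν := fun f => by
    refine (L2.integrable_inner f (mulLp F hb f) (𝕜 := ℂ)).congr ?_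
    filter_upwards [coeFn_mulLp hb f] with x hx
    rw [hx, inner_smul_right]
  have hre : ∀ f : Lp F 2 ν, (mulLp F hb).reApplyInnerSelf f = ∫ x, (b x).re * ‖f x‖ ^ 2 ∂ν := by
    intro f
    rw [ContinuousLinearMap.reApplyInnerSelf_apply, inner_re_symm, inner_mulLp]
    refine (integral_re (hint f)).symm.trans (integral_congr_ae (.of_forall fun x => ?_))
    simp only [inner_self_eq_norm_sq_to_K]
    rw [← RCLike.ofReal_pow, RCLike.re_mul_ofReal]
    rfl
  rw [ContinuousLinearMap.isPositive_def, ← ContinuousLinearMap.isSelfAdjoint_iff_isSymmetric,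
    isSelfAdjoint_mulLp_iff, eventually_and, and_comm]
  refine and_congr_left fun _ => ⟨fun h => ?_, fun h f => ?_⟩
  · obtain ⟨v, hv⟩ := exists_ne (0 : F)
    have hbi : ∀ s : Set α, MeasurableSet s → ν s < ∞ → IntegrableOn (fun x => (b x).re) s ν := by
      intro s hs hνs
      have : IsFiniteMeasure (ν.restrict s) := isFiniteMeasure_restrict.2 hνs.ne
      exact (((hb.restrict s).mono_exponent le_top).integrable le_rfl).re
    refine ae_nonneg_of_forall_setIntegral_nonneg_of_sigmaFinite hbi fun s hs hνs => ?_
    have h1 := h (indicatorConstLp 2 hs hνs.ne v)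
    have h2 : ∫ x, (b x).re * ‖indicatorConstLp 2 hs hνs.ne v x‖ ^ 2 ∂ν
        = (∫ x in s, (b x).re ∂ν) * ‖v‖ ^ 2 := by
      rw [← integral_mul_const, ← integral_indicator hs]
      refine integral_congr_ae ?_
      filter_upwards [indicatorConstLp_coeFn (p := 2) (hs := hs) (hμs := hνs.ne) (c := v)]
        with x hx
      rw [hx]
      by_cases hxs : x ∈ s <;> simp [hxs]
    rw [hre, h2] at h1
    exact nonneg_of_mul_nonneg_left h1 (by positivity)
  · rw [hre]
    exact integral_nonneg_of_ae (by
      filter_upwards [h] with x hx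
      exact mul_nonneg hx (sq_nonneg _))

theorem mulLp_isometry_iff [CompleteSpace F] [SigmaFinite ν] [Nontrivial F] {b : α → ℂ}
    (hb : MemLp b ∞ ν) :
    (star (mulLp F hb) * mulLp F hb = 1 ∧ mulLp F hb * star (mulLp F hb) = 1) ↔
      ∀ᵐ x ∂ν, ‖b x‖ = 1 := by
  have h1 : MemLp (1 : α → ℂ) ∞ ν := memLp_top_const 1
  have h2 : MemLp (star b * b) ∞ ν := hb.mul hb.star
  have h3 : MemLp (b * star b) ∞ ν := hb.star.mul hb
  rw [adjoint_mulLp, mulLp_mul _ _ h2, mulLp_mul _ _ h3, ← mulLp_one h1, mulLp_eq_iff,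
    mulLp_eq_iff, mul_comm b, and_self]
  refine eventually_congr (.of_forall fun x => ?_)
  simp only [Pi.mul_apply, Pi.star_apply, Pi.one_apply, RCLike.star_def]
  rw [Complex.conj_mul', ← Complex.ofReal_pow, Complex.ofReal_eq_one,
    pow_eq_one_iff_of_nonneg (norm_nonneg _) two_ne_zero]

end MulOperator

/-- Self-adjointness, positivity and unitarity are invariant under unitary equivalence. -/
theorem properties_conjStarAlgEquiv_iff {H K : Type*}
    [NormedAddCommGroup H] [InnerProductSpace ℂ H] [CompleteSpace H]
    [NormedAddCommGroup K] [InnerProductSpace ℂ K] [CompleteSpace K]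
    (W : H ≃ₗᵢ[ℂ] K) {T : H →L[ℂ] H} {S : K →L[ℂ] K} (hT : W.conjStarAlgEquiv T = S) :
    (IsSelfAdjoint T ↔ IsSelfAdjoint S) ∧ (T.IsPositive ↔ S.IsPositive) ∧
    ((star T * T = 1 ∧ T * star T = 1) ↔ (star S * S = 1 ∧ S * star S = 1)) := by
  have hsa : IsSelfAdjoint T ↔ IsSelfAdjoint S := by
    rw [isSelfAdjoint_iff, isSelfAdjoint_iff, ← hT, ← map_star, EmbeddingLike.apply_eq_iff_eq]
  refine ⟨hsa, ?_, ?_⟩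
  · rw [ContinuousLinearMap.isPositive_def,
      ContinuousLinearMap.isPositive_def, ← ContinuousLinearMap.isSelfAdjoint_iff_isSymmetric,
      ← ContinuousLinearMap.isSelfAdjoint_iff_isSymmetric, hsa]
    refine and_congr_right fun _ => ?_
    rw [W.surjective.forall]
    refine forall_congr' fun x => ?_
    rw [← hT, ContinuousLinearMap.reApplyInnerSelf_apply,
      ContinuousLinearMap.reApplyInnerSelf_apply, LinearIsometryEquiv.conjStarAlgEquiv_apply_apply,
      W.symm_apply_apply, W.inner_map_map]
  · rw [← hT, ← map_star, ← map_mul, ← map_mul,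
      EmbeddingLike.map_eq_one_iff, EmbeddingLike.map_eq_one_iff]

section Translation
open scoped FourierTransform RealInnerProductSpace SchwartzMap

variable {E F : Type*} [NormedAddCommGroup E] [InnerProductSpace ℝ E] [FiniteDimensional ℝ E]
  [MeasurableSpace E] [BorelSpace E]
  [NormedAddCommGroup F] [InnerProductSpace ℂ F] [CompleteSpace F]

theorem memLp_top_fourierChar (t : E) :
    MemLp (fun s => (Real.fourierChar ⟪t, s⟫ : ℂ)) ∞ (volume : Measure E) := by
  refine memLp_top_of_bound (by fun_prop) 1 (.of_forall fun s => ?_)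
  exact (Circle.norm_coe _).le

/-- The Fourier transform on `L²` turns translations into multiplications by characters. -/
theorem fourier_compMeasurePreserving_add_right (t : E) (f : Lp F 2 (volume : Measure E)) :
    Lp.fourierTransformₗᵢ E F
        (Lp.compMeasurePreserving (· + t) (measurePreserving_add_right volume t) f) =
      mulLp F (memLp_top_fourierChar t) (Lp.fourierTransformₗᵢ E F f) := by
  refine DenseRange.induction_on (SchwartzMap.denseRange_toLpCLM (p := 2) ENNReal.ofNat_ne_top) f
    (isClosed_eq ?_ ?_) fun g => ?_
  · exact (Lp.fourierTransformₗᵢ E F).continuous.comp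
      (Lp.isometry_compMeasurePreserving (measurePreserving_add_right volume t)).continuous
  · exact (mulLp F (memLp_top_fourierChar t)).continuous.comp (Lp.fourierTransformₗᵢ E F).continuous
  · change 𝓕 (Lp.compMeasurePreserving (· + t) (measurePreserving_add_right volume t) (g.toLp 2))
      = mulLp F (memLp_top_fourierChar t) (𝓕 (g.toLp 2))
    have h1 : Lp.compMeasurePreserving (· + t) (measurePreserving_add_right volume t) (g.toLp 2)
        = (g.compSubConstCLM ℂ (-t)).toLp 2 := by
      refine Lp.ext ?_
      have h2 := (measurePreserving_add_right volume t).quasiMeasurePreserving.ae_eq_comp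
        (g.coeFn_toLp 2 volume)
      filter_upwards [Lp.coeFn_compMeasurePreserving (g.toLp 2) (measurePreserving_add_right volume t),
        h2, (g.compSubConstCLM ℂ (-t)).coeFn_toLp 2] with x h1 h2 h3
      rw [h1, h3, h2, Function.comp_apply, SchwartzMap.compSubConstCLM_apply, sub_neg_eq_add]
    rw [h1, SchwartzMap.toLp_fourier_eq, SchwartzMap.toLp_fourier_eq]
    refine Lp.ext ?_
    filter_upwards [coeFn_mulLp (memLp_top_fourierChar t) ((𝓕 g).toLp 2), (𝓕 g).coeFn_toLp 2,
      (𝓕 (g.compSubConstCLM ℂ (-t))).coeFn_toLp 2] with x h1 h2 h3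
    rw [h1, h2, h3, SchwartzMap.fourier_coe, SchwartzMap.fourier_coe]
    have h4 : ⇑(g.compSubConstCLM ℂ (-t)) = ⇑g ∘ fun v => v + t := by
      ext v
      rw [SchwartzMap.compSubConstCLM_apply, sub_neg_eq_add, Function.comp_apply]
    rw [h4]
    exact congrFun (VectorFourier.fourierIntegral_comp_add_right Real.fourierChar volume
      (innerₗ E) g t) x

end Translation

section Orthants

variable {n : ℕ}

/-- The sign `±1` encoded by a Boolean. -/
def boolSign (b : Bool) : ℝ := if b then 1 else -1

theorem boolSign_mul_self (b : Bool) : boolSign b * boolSign b = 1 := by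
  cases b <;> simp [boolSign]

theorem abs_boolSign (b : Bool) : |boolSign b| = 1 := by
  cases b <;> simp [boolSign]

theorem boolSign_decide_mul_abs (x : ℝ) : boolSign (decide (0 < x)) * |x| = x := by
  by_cases hx : 0 < x
  · simp [boolSign, hx, abs_of_pos hx]
  · simp [boolSign, hx, abs_of_nonpos (not_lt.1 hx)]

/-- Logarithmic coordinates on the open orthant with sign pattern `ε`. -/
noncomputable def signedExp (ε : Fin n → Bool) (y : Fin n → ℝ) : Fin n → ℝ :=
  fun j => boolSign (ε j) * Real.exp (y j)

theorem hasFDerivAt_signedExp (ε : Fin n → Bool) (y : Fin n → ℝ) :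
    HasFDerivAt (signedExp ε)
      (LinearMap.toContinuousLinearMap
        (Matrix.toLin' (Matrix.diagonal (signedExp ε y)))) y := by
  rw [hasFDerivAt_pi']
  intro j
  have h : HasFDerivAt (fun z : Fin n → ℝ => boolSign (ε j) * Real.exp (z j))
      (boolSign (ε j) • (Real.exp (y j) • ContinuousLinearMap.proj (R := ℝ) j)) y :=
    ((hasFDerivAt_apply j y).exp).const_mul _
  refine h.congr_fderiv (ContinuousLinearMap.ext fun z => ?_)
  simp [signedExp, Matrix.mulVec_diagonal, mul_assoc]

theorem signedExp_injective (ε : Fin n → Bool) : Function.Injective (signedExp ε) := by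
  intro y z h
  ext j
  have := congrArg (boolSign (ε j) * ·) (congrFun h j)
  simpa [signedExp, ← mul_assoc, boolSign_mul_self] using this

theorem continuous_signedExp (ε : Fin n → Bool) : Continuous (signedExp ε) := by
  unfold signedExp; fun_prop

theorem signedExp_log {x : Fin n → ℝ} (hx : ∀ j, x j ≠ 0) :
    signedExp (fun j => decide (0 < x j)) (fun j => Real.log (x j)) = x := by
  ext j
  rw [signedExp, Real.exp_log_eq_abs (hx j), boolSign_decide_mul_abs]

theorem decide_pos_signedExp (ε : Fin n → Bool) (y : Fin n → ℝ) (j : Fin n) :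
    decide (0 < signedExp ε y j) = ε j := by
  have := Real.exp_pos (y j)
  cases h : ε j <;> simp [signedExp, boolSign, h, this, this.le]

theorem log_signedExp (ε : Fin n → Bool) (y : Fin n → ℝ) (j : Fin n) :
    Real.log (signedExp ε y j) = y j := by
  rw [← Real.log_abs, signedExp, abs_mul, abs_boolSign, one_mul, Real.abs_exp, Real.log_exp]

theorem ae_forall_ne_zero : ∀ᵐ x : Fin n → ℝ, ∀ j, x j ≠ 0 := by
  rw [ae_all_iff]
  intro j
  exact (Measure.quasiMeasurePreserving_eval (fun _ => (volume : Measure ℝ)) j).ae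
    (Measure.ae_ne volume 0)

/-- Integration over `ℝⁿ` in logarithmic coordinates on each of the orthants. -/
theorem lintegral_eq_sum_signedExp (G : (Fin n → ℝ) → ℝ≥0∞) :
    ∫⁻ x, G x = ∑ ε : Fin n → Bool,
      ∫⁻ y : Fin n → ℝ, ENNReal.ofReal (Real.exp (∑ j, y j)) * G (signedExp ε y) := by
  have hm : ∀ ε : Fin n → Bool, MeasurableSet (Set.range (signedExp ε)) := fun ε =>
    ((continuous_signedExp ε).measurableEmbedding (signedExp_injective ε)).measurableSet_range
  have hd : Pairwise (Function.onFun Disjoint fun ε : Fin n → Bool => Set.range (signedExp ε)) := by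
    intro ε ε' hne
    refine Set.disjoint_left.2 ?_
    rintro _ ⟨y, rfl⟩ ⟨z, hz⟩
    refine hne (funext fun j => ?_)
    rw [← decide_pos_signedExp ε y, ← hz, decide_pos_signedExp]
  have hu : (⋃ ε : Fin n → Bool, Set.range (signedExp ε)) =ᵐ[volume] Set.univ := by
    rw [eventuallyEq_univ]
    filter_upwards [ae_forall_ne_zero (n := n)] with x hx
    exact Set.mem_iUnion.2 ⟨_, _, signedExp_log hx⟩
  rw [← setLIntegral_univ, ← setLIntegral_congr hu, lintegral_iUnion hm hd, tsum_fintype]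
  refine Finset.sum_congr rfl fun ε _ => ?_
  rw [← Set.image_univ, lintegral_image_eq_lintegral_abs_det_fderiv_mul volume MeasurableSet.univ
    (fun y _ => (hasFDerivAt_signedExp ε y).hasFDerivWithinAt) (signedExp_injective ε).injOn,
    setLIntegral_univ]
  refine lintegral_congr fun y => ?_
  congr 2
  rw [LinearMap.det_toContinuousLinearMap, LinearMap.det_toLin', Matrix.det_diagonal,
    Finset.abs_prod, Real.exp_sum]
  exact Finset.prod_congr rfl fun j _ => by simp [signedExp, abs_mul, abs_boolSign]

/-- Logarithmic coordinates on the orthants with respect to the orthonormal basis formed by the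
rows of `C`. -/
noncomputable def orthantMap (C : Matrix (Fin n) (Fin n) ℝ) (ε : Fin n → Bool)
    (y : EuclideanSpace ℝ (Fin n)) : Fin n → ℝ :=
  C⁻¹ *ᵥ signedExp ε y.ofLp

theorem measurePreserving_inv_mulVec {C : Matrix (Fin n) (Fin n) ℝ} (hC : C * Cᵀ = 1) :
    MeasurePreserving (fun x : Fin n → ℝ => C⁻¹ *ᵥ x) := by
  have h1 : C.det * C.det = 1 := by
    have := congrArg Matrix.det hC
    rwa [Matrix.det_mul, Matrix.det_transpose, Matrix.det_one] at this
  have h2 : |C⁻¹.det| = 1 := by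
    have : |C.det| = 1 := by
      rcases mul_self_eq_one_iff.1 h1 with h | h <;> simp [h]
    rw [Matrix.det_nonsing_inv, Ring.inverse_eq_inv', abs_inv, this, inv_one]
  have h3 : C⁻¹.det ≠ 0 := fun h => by simp [h] at h2
  refine ⟨by fun_prop, ?_⟩
  have := Real.map_matrix_volume_pi_eq_smul_volume_pi h3
  rwa [abs_inv, h2, inv_one, ENNReal.ofReal_one, one_smul] at this

theorem lintegral_eq_sum_orthantMap {C : Matrix (Fin n) (Fin n) ℝ} (hC : C * Cᵀ = 1)
    {G : (Fin n → ℝ) → ℝ≥0∞} (hG : Measurable G) :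
    ∫⁻ x, G x = ∑ ε : Fin n → Bool, ∫⁻ y : EuclideanSpace ℝ (Fin n),
      ENNReal.ofReal (Real.exp (∑ j, y j)) * G (orthantMap C ε y) := by
  rw [← (measurePreserving_inv_mulVec hC).lintegral_comp hG, lintegral_eq_sum_signedExp]
  refine Finset.sum_congr rfl fun ε _ => ?_
  exact ((EuclideanSpace.volume_preserving_symm_measurableEquiv_toLp (Fin n)).lintegral_comp_emb
    (MeasurableEquiv.measurableEmbedding _) _).symm

theorem continuous_orthantMap (C : Matrix (Fin n) (Fin n) ℝ) (ε : Fin n → Bool) :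
    Continuous (orthantMap C ε) := by
  unfold orthantMap
  have := continuous_signedExp ε
  fun_prop

theorem quasiMeasurePreserving_orthantMap {C : Matrix (Fin n) (Fin n) ℝ} (hC : C * Cᵀ = 1)
    (ε : Fin n → Bool) : Measure.QuasiMeasurePreserving (orthantMap C ε) := by
  refine ⟨(continuous_orthantMap C ε).measurable, .mk fun s hs h => ?_⟩
  rw [Measure.map_apply (continuous_orthantMap C ε).measurable hs]
  have h1 := lintegral_eq_sum_orthantMap hC (G := s.indicator 1) (measurable_one.indicator hs)
  rw [lintegral_indicator_one hs, h, eq_comm, Finset.sum_eq_zero_iff] at h1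
  have h2 := h1 ε (Finset.mem_univ _)
  have hm : Measurable fun y : EuclideanSpace ℝ (Fin n) =>
      ENNReal.ofReal (Real.exp (∑ j, y j)) * s.indicator 1 (orthantMap C ε y) := by
    have := (measurable_one.indicator hs (f := (1 : (Fin n → ℝ) → ℝ≥0∞))).comp
      (continuous_orthantMap C ε).measurable
    exact Measurable.mul (by fun_prop) this
  rw [lintegral_eq_zero_iff hm] at h2
  refine measure_mono_null (fun y hy => ?_) h2
  rw [Set.mem_preimage] at hy
  simp [hy, Real.exp_pos]

end Orthants

section OrthantCoordinates

variable {n : ℕ} {C : Matrix (Fin n) (Fin n) ℝ}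

/-- The function `f` in logarithmic coordinates, as a vector indexed by the orthants, with the
normalization that makes this operation isometric on `L²`. -/
noncomputable def orthantCoord (C : Matrix (Fin n) (Fin n) ℝ) (f : (Fin n → ℝ) → ℂ)
    (y : EuclideanSpace ℝ (Fin n)) : EuclideanSpace ℂ (Fin n → Bool) :=
  WithLp.toLp 2 fun ε => (Real.exp ((∑ j, y j) / 2) : ℂ) * f (orthantMap C ε y)

theorem orthantCoord_congr_ae (hC : C * Cᵀ = 1) {f g : (Fin n → ℝ) → ℂ} (h : f =ᵐ[volume] g) :
    orthantCoord C f =ᵐ[volume] orthantCoord C g := by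
  have h1 : ∀ᵐ y, ∀ ε, f (orthantMap C ε y) = g (orthantMap C ε y) :=
    ae_all_iff.2 fun ε => (quasiMeasurePreserving_orthantMap hC ε).ae_eq_comp h
  filter_upwards [h1] with y hy
  simp only [orthantCoord, hy]

theorem measurable_orthantCoord {f : (Fin n → ℝ) → ℂ} (hf : Measurable f) :
    Measurable (orthantCoord C f) := by
  refine (WithLp.measurable_toLp 2 _).comp (measurable_pi_lambda _ fun ε => ?_)
  have := hf.comp (continuous_orthantMap C ε).measurable
  exact Measurable.mul (by fun_prop) this

theorem enorm_orthantCoord_sq (f : (Fin n → ℝ) → ℂ) (y : EuclideanSpace ℝ (Fin n)) :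
    ‖orthantCoord C f y‖ₑ ^ 2 =
      ∑ ε, ENNReal.ofReal (Real.exp (∑ j, y j)) * ‖f (orthantMap C ε y)‖ₑ ^ 2 := by
  simp_rw [← ofReal_norm, ← ENNReal.ofReal_pow (norm_nonneg _),
    ← ENNReal.ofReal_mul (Real.exp_pos _).le]
  rw [EuclideanSpace.norm_sq_eq, ENNReal.ofReal_sum_of_nonneg fun _ _ => sq_nonneg _]
  refine Finset.sum_congr rfl fun ε _ => ?_
  rw [orthantCoord, norm_mul, mul_pow, Complex.norm_real, Real.norm_eq_abs, Real.abs_exp,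
    ← Real.exp_nat_mul]
  congr 3
  push_cast
  ring

theorem eLpNorm_orthantCoord (hC : C * Cᵀ = 1) {f : (Fin n → ℝ) → ℂ}
    (hf : AEStronglyMeasurable f) : eLpNorm (orthantCoord C f) 2 = eLpNorm f 2 := by
  rw [eLpNorm_congr_ae (orthantCoord_congr_ae hC hf.ae_eq_mk), eLpNorm_congr_ae hf.ae_eq_mk]
  have hm : Measurable (hf.mk f) := hf.stronglyMeasurable_mk.measurable
  have hf2 : Measurable fun x => ‖hf.mk f x‖ₑ ^ 2 := by fun_prop
  rw [eLpNorm_eq_lintegral_rpow_enorm_toReal two_ne_zero ENNReal.ofNat_ne_top,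
    eLpNorm_eq_lintegral_rpow_enorm_toReal two_ne_zero ENNReal.ofNat_ne_top]
  simp only [ENNReal.toReal_ofNat, ENNReal.rpow_ofNat, enorm_orthantCoord_sq]
  rw [lintegral_eq_sum_orthantMap hC hf2, lintegral_finsetSum]
  intro ε _
  have := hf2.comp (continuous_orthantMap C ε).measurable
  exact Measurable.mul (by fun_prop) this

theorem memLp_orthantCoord (hC : C * Cᵀ = 1) {f : (Fin n → ℝ) → ℂ} (hf : MemLp f 2) :
    MemLp (orthantCoord C f) 2 := by
  refine ⟨?_, (eLpNorm_orthantCoord hC hf.1).trans_lt hf.2⟩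
  exact ⟨_, (measurable_orthantCoord hf.1.stronglyMeasurable_mk.measurable).stronglyMeasurable,
    orthantCoord_congr_ae hC hf.1.ae_eq_mk⟩

/-- The passage to logarithmic coordinates as an isometry of `L²` spaces. -/
noncomputable def orthantIsometry (hC : C * Cᵀ = 1) :
    Lp ℂ 2 (volume : Measure (Fin n → ℝ)) →ₗᵢ[ℂ]
      Lp (EuclideanSpace ℂ (Fin n → Bool)) 2 (volume : Measure (EuclideanSpace ℝ (Fin n))) where
  toFun f := (memLp_orthantCoord hC (Lp.memLp f)).toLp _
  map_add' f g := by
    rw [← MemLp.toLp_add, MemLp.toLp_eq_toLp_iff]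
    refine (orthantCoord_congr_ae hC (Lp.coeFn_add f g)).trans (.of_forall fun y => ?_)
    ext ε
    simp [orthantCoord, mul_add]
  map_smul' c f := by
    rw [RingHom.id_apply, ← MemLp.toLp_const_smul, MemLp.toLp_eq_toLp_iff]
    refine (orthantCoord_congr_ae hC (Lp.coeFn_smul c f)).trans (.of_forall fun y => ?_)
    ext ε
    simp [orthantCoord, mul_left_comm]
  norm_map' f := by
    change ‖(memLp_orthantCoord hC (Lp.memLp f)).toLp _‖ = _
    rw [Lp.norm_toLp, eLpNorm_orthantCoord hC (Lp.memLp f).1, Lp.norm_def]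

theorem coeFn_orthantIsometry (hC : C * Cᵀ = 1) (f : Lp ℂ 2 (volume : Measure (Fin n → ℝ))) :
    orthantIsometry hC f =ᵐ[volume] orthantCoord C f :=
  (memLp_orthantCoord hC (Lp.memLp f)).coeFn_toLp

theorem isUnit_det_of_mul_transpose (hC : C * Cᵀ = 1) : IsUnit C.det := by
  have := congrArg Matrix.det hC
  rw [Matrix.det_mul, Matrix.det_one] at this
  exact .of_mul_eq_one _ this

theorem orthantIsometry_surjective (hC : C * Cᵀ = 1) :
    Function.Surjective (orthantIsometry hC) := by
  intro h
  have hdet := isUnit_det_of_mul_transpose hC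
  set f : (Fin n → ℝ) → ℂ := fun x =>
    (Real.exp (-(∑ j, Real.log ((C *ᵥ x) j)) / 2) : ℂ) *
      h (WithLp.toLp 2 fun j => Real.log ((C *ᵥ x) j)) (fun j => decide (0 < (C *ᵥ x) j)) with hf
  have hmh : Measurable h := (Lp.stronglyMeasurable h).measurable
  have hmf : Measurable f := by
    have hl : Measurable fun x : Fin n → ℝ =>
        (WithLp.toLp 2 fun j => Real.log ((C *ᵥ x) j) : EuclideanSpace ℝ (Fin n)) := by
      refine (WithLp.measurable_toLp 2 _).comp (measurable_pi_lambda _ fun j => ?_)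
      exact Real.measurable_log.comp (by fun_prop)
    have hs : Measurable fun x : Fin n → ℝ => fun j => decide (0 < (C *ᵥ x) j) := by
      refine measurable_pi_lambda _ fun j => measurable_to_bool ?_
      have : Measurable fun x : Fin n → ℝ => (C *ᵥ x) j := by fun_prop
      simpa [Set.preimage] using measurableSet_lt measurable_const this
    have he : Measurable fun p : EuclideanSpace ℂ (Fin n → Bool) × (Fin n → Bool) => p.1 p.2 := by
      refine measurable_from_prod_countable_left fun ε => ?_
      exact (measurable_pi_apply ε).comp (WithLp.measurable_ofLp 2 _)
    have := he.comp ((hmh.comp hl).prodMk hs)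
    refine Measurable.mul ?_ this
    have : Measurable fun x : Fin n → ℝ => ∑ j, Real.log ((C *ᵥ x) j) :=
      Finset.measurable_sum _ fun j _ => Real.measurable_log.comp (by fun_prop)
    fun_prop
  have hfh : orthantCoord C f = h := by
    ext y ε
    have h1 : C *ᵥ orthantMap C ε y = signedExp ε y.ofLp := by
      rw [orthantMap, Matrix.mulVec_mulVec, Matrix.mul_nonsing_inv _ hdet, Matrix.one_mulVec]
    simp only [orthantCoord, hf, h1, log_signedExp, decide_pos_signedExp]
    rw [← mul_assoc, ← Complex.ofReal_mul, ← Real.exp_add]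
    ring_nf
    simp
  have hfL : MemLp f 2 := ⟨hmf.aestronglyMeasurable, by
    rw [← eLpNorm_orthantCoord hC hmf.aestronglyMeasurable, hfh]
    exact (Lp.memLp h).2⟩
  refine ⟨hfL.toLp f, Lp.ext ?_⟩
  rw [← hfh]
  exact (coeFn_orthantIsometry hC _).trans (orthantCoord_congr_ae hC hfL.coeFn_toLp)

/-- The passage to logarithmic coordinates followed by the Fourier transform: a multidimensional
Mellin transform, as a unitary operator. -/
noncomputable def mellinEquiv (hC : C * Cᵀ = 1) :
    Lp ℂ 2 (volume : Measure (Fin n → ℝ)) ≃ₗᵢ[ℂ]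
      Lp (EuclideanSpace ℂ (Fin n → Bool)) 2 (volume : Measure (EuclideanSpace ℝ (Fin n))) :=
  (LinearIsometryEquiv.ofSurjective (orthantIsometry hC) (orthantIsometry_surjective hC)).trans
    (Lp.fourierTransformₗᵢ _ _)

end OrthantCoordinates

section TranslationAverage
open scoped RealInnerProductSpace

variable {Ω E : Type*} [MeasurableSpace Ω] {μ : Measure Ω}
  [NormedAddCommGroup E] [InnerProductSpace ℝ E] [FiniteDimensional ℝ E]
  [MeasurableSpace E] [BorelSpace E]

theorem integrable_norm_sq_translate [SigmaFinite μ] {F : Type*} [NormedAddCommGroup F]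
    {κ : Ω → ℂ} (hκ : Integrable κ μ)
    {t : Ω → E} (ht : Measurable t) (h : Lp F 2 (volume : Measure E)) :
    Integrable (fun p : Ω × E => ‖κ p.1‖ * ‖h (p.2 + t p.1)‖ ^ 2) (μ.prod volume) := by
  have hmp : MeasurePreserving (fun p : Ω × E => (p.1, p.2 + t p.1)) (μ.prod volume)
      (μ.prod volume) :=
    (MeasurePreserving.id μ).skew_product (g := fun u y => y + t u) (by fun_prop)
      (.of_forall fun u => map_add_right_eq_self volume (t u))
  exact hmp.integrable_comp_of_integrable (g := fun p : Ω × E => ‖κ p.1‖ * ‖h p.2‖ ^ 2)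
    (hκ.norm.mul_prod ((memLp_two_iff_integrable_sq_norm (Lp.memLp h).1).1 (Lp.memLp h)))

/-- The symbol of an average of translations. -/
noncomputable def translationSymbol (μ : Measure Ω) (κ : Ω → ℂ) (t : Ω → E) (s : E) : ℂ :=
  ∫ u, κ u * Real.fourierChar ⟪t u, s⟫ ∂μ

theorem continuous_translationSymbol {κ : Ω → ℂ} (hκ : Integrable κ μ)
    {t : Ω → E} (ht : Measurable t) : Continuous (translationSymbol μ κ t) := by
  refine continuous_of_dominated (bound := fun u => ‖κ u‖) (fun s => ?_)
    (fun s => .of_forall fun u => ?_) hκ.norm (.of_forall fun u => ?_)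
  · exact hκ.1.mul (by fun_prop)
  · rw [norm_mul, Circle.norm_coe, mul_one]
  · fun_prop

theorem memLp_translationSymbol {κ : Ω → ℂ} (hκ : Integrable κ μ)
    {t : Ω → E} (ht : Measurable t) : MemLp (translationSymbol μ κ t) ∞ volume := by
  refine memLp_top_of_bound (continuous_translationSymbol hκ ht).aestronglyMeasurable
    (∫ u, ‖κ u‖ ∂μ) (.of_forall fun s => (norm_integral_le_integral_norm _).trans_eq ?_)
  simp only [norm_mul, Circle.norm_coe, mul_one]

/-- An operator on `L²` which averages translations becomes multiplication by its symbol under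
the Fourier transform. -/
theorem fourier_translationAverage [SigmaFinite μ] {ι : Type*} [Fintype ι] {κ : Ω → ℂ}
    (hκ : Integrable κ μ)
    {t : Ω → E} (ht : Measurable t) (h g k : Lp (EuclideanSpace ℂ ι) 2 (volume : Measure E))
    (hg : ∀ i, ∀ᵐ y, g y i = ∫ u, κ u * h (y + t u) i ∂μ) :
    inner ℂ k g = inner ℂ (Lp.fourierTransformₗᵢ _ _ k)
      (mulLp _ (memLp_translationSymbol hκ ht) (Lp.fourierTransformₗᵢ _ _ h)) := by
  have hh := Lp.stronglyMeasurable h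
  have hk := Lp.stronglyMeasurable k
  have hht : StronglyMeasurable fun p : Ω × E => h (p.2 + t p.1) :=
    hh.comp_measurable (by fun_prop)
  have hkt : StronglyMeasurable fun p : Ω × E => k p.2 := hk.comp_measurable measurable_snd
  have hco : ∀ i, Continuous fun v : EuclideanSpace ℂ ι => v i := fun i => by fun_prop
  have hκp : AEStronglyMeasurable (fun p : Ω × E => κ p.1) (μ.prod volume) := hκ.1.comp_fst
  have hD : Integrable (fun p : Ω × E => ‖κ p.1‖ * ‖k p.2‖ ^ 2 + ‖κ p.1‖ * ‖h (p.2 + t p.1)‖ ^ 2)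
      (μ.prod volume) :=
    (hκ.norm.mul_prod ((memLp_two_iff_integrable_sq_norm (Lp.memLp k).1).1 (Lp.memLp k))).add
      (integrable_norm_sq_translate hκ ht h)
  have hbound : ∀ p : Ω × E, ‖κ p.1‖ * (‖k p.2‖ * ‖h (p.2 + t p.1)‖) ≤
      ‖κ p.1‖ * ‖k p.2‖ ^ 2 + ‖κ p.1‖ * ‖h (p.2 + t p.1)‖ ^ 2 := by
    intro p
    rw [← mul_add]
    refine mul_le_mul_of_nonneg_left ?_ (norm_nonneg _)
    nlinarith [sq_nonneg (‖k p.2‖ - ‖h (p.2 + t p.1)‖), sq_nonneg ‖k p.2‖,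
      sq_nonneg ‖h (p.2 + t p.1)‖]
  have hI : Integrable (fun p : Ω × E => κ p.1 * inner ℂ (k p.2) (h (p.2 + t p.1)))
      (μ.prod volume) := by
    refine hD.mono' (hκp.mul (hkt.inner hht).aestronglyMeasurable) (.of_forall fun p => ?_)
    rw [norm_mul]
    exact (mul_le_mul_of_nonneg_left (norm_inner_le_norm _ _) (norm_nonneg _)).trans (hbound p)
  have hIi : ∀ i, Integrable (fun p : Ω × E => conj (k p.2 i) * (κ p.1 * h (p.2 + t p.1) i))
      (μ.prod volume) := by
    intro i
    refine hD.mono' ?_ (.of_forall fun p => ?_)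
    · exact (Complex.continuous_conj.comp_stronglyMeasurable
        ((hco i).comp_stronglyMeasurable hkt)).aestronglyMeasurable.mul
        (hκp.mul ((hco i).comp_stronglyMeasurable hht).aestronglyMeasurable)
    · rw [norm_mul, norm_mul, RCLike.norm_conj, mul_left_comm]
      refine le_trans ?_ (hbound p)
      gcongr <;> exact PiLp.norm_apply_le _ _
  have hIs : ∀ᵐ y, ∀ i, Integrable (fun u => conj (k y i) * (κ u * h (y + t u) i)) μ :=
    ae_all_iff.2 fun i => (hIi i).prod_left_ae
  have h1 : inner ℂ k g = ∫ y, ∫ u, κ u * inner ℂ (k y) (h (y + t u)) ∂μ := by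
    rw [L2.inner_def]
    refine integral_congr_ae ?_
    filter_upwards [hIs, ae_all_iff.2 hg] with y hy hgy
    rw [PiLp.inner_apply]
    have : ∀ i, inner ℂ (k y i) (g y i) = ∫ u, conj (k y i) * (κ u * h (y + t u) i) ∂μ := by
      intro i
      rw [hgy, RCLike.inner_apply, mul_comm, integral_const_mul]
    simp only [this]
    rw [← integral_finsetSum _ fun i _ => hy i]
    refine integral_congr_ae (.of_forall fun u => ?_)
    simp only [PiLp.inner_apply, RCLike.inner_apply, Finset.mul_sum]
    exact Finset.sum_congr rfl fun i _ => by ring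
  have h2 : ∀ u, ∫ y, inner ℂ (k y) (h (y + t u)) =
      ∫ s, Real.fourierChar ⟪t u, s⟫ * inner ℂ (Lp.fourierTransformₗᵢ _ _ k s)
        (Lp.fourierTransformₗᵢ _ _ h s) := by
    intro u
    rw [← inner_mulLp (memLp_top_fourierChar (t u)), ← fourier_compMeasurePreserving_add_right,
      LinearIsometryEquiv.inner_map_map, L2.inner_def]
    refine integral_congr_ae ?_
    filter_upwards [Lp.coeFn_compMeasurePreserving h (measurePreserving_add_right volume (t u))]
      with y hy
    rw [hy, Function.comp_apply]
  have hF : Integrable (fun p : Ω × E => κ p.1 * (Real.fourierChar ⟪t p.1, p.2⟫ *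
      inner ℂ (Lp.fourierTransformₗᵢ _ _ k p.2) (Lp.fourierTransformₗᵢ _ _ h p.2)))
      (μ.prod volume) := by
    have h3 := hκ.mul_prod (L2.integrable_inner (𝕜 := ℂ) (Lp.fourierTransformₗᵢ _ _ k)
      (Lp.fourierTransformₗᵢ _ _ h))
    have hm : AEStronglyMeasurable (fun p : Ω × E => (Real.fourierChar ⟪t p.1, p.2⟫ : ℂ))
        (μ.prod volume) := by
      have : Measurable fun p : Ω × E => ⟪t p.1, p.2⟫ := by fun_prop
      have h4 : Continuous fun x : ℝ => (Real.fourierChar x : ℂ) := by fun_prop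
      exact (h4.measurable.comp this).aestronglyMeasurable
    refine (h3.bdd_mul (c := 1) hm (.of_forall fun p => (Circle.norm_coe _).le)).congr
      (.of_forall fun p => ?_)
    exact mul_left_comm _ _ _
  have h3 := integral_integral_swap
    (f := fun (u : Ω) (y : E) => κ u * inner ℂ (k y) (h (y + t u))) hI
  rw [h1, ← h3, inner_mulLp]
  simp only [integral_const_mul, h2]
  simp only [← integral_const_mul]
  rw [integral_integral_swap hF]
  refine integral_congr_ae (.of_forall fun s => ?_)
  simp only [translationSymbol, ← integral_mul_const, mul_assoc]

end TranslationAverage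

section HausdorffOperator
open scoped RealInnerProductSpace

variable {Ω : Type*} [MeasurableSpace Ω] {μ : Measure Ω}
  {n : ℕ} {C : Matrix (Fin n) (Fin n) ℝ}

/-- The positive matrix with eigenvalues `exp (t j)` and eigenvectors the rows of `C`. -/
noncomputable def expMatrix (C : Matrix (Fin n) (Fin n) ℝ) (t : EuclideanSpace ℝ (Fin n)) :
    Matrix (Fin n) (Fin n) ℝ :=
  C⁻¹ * Matrix.diagonal (fun j => Real.exp (t j)) * C

theorem expMatrix_mulVec_orthantMap (hC : C * Cᵀ = 1) (ε : Fin n → Bool)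
    (t y : EuclideanSpace ℝ (Fin n)) :
    expMatrix C t *ᵥ orthantMap C ε y = orthantMap C ε (y + t) := by
  rw [expMatrix, orthantMap, orthantMap, Matrix.mulVec_mulVec,
    Matrix.mul_nonsing_inv_cancel_right _ _ (isUnit_det_of_mul_transpose hC),
    ← Matrix.mulVec_mulVec]
  congr 1
  ext j
  rw [Matrix.mulVec_diagonal, signedExp, signedExp, WithLp.ofLp_add, Pi.add_apply, Real.exp_add]
  ring

theorem quasiMeasurePreserving_expMatrix (hC : C * Cᵀ = 1) (t : EuclideanSpace ℝ (Fin n)) :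
    Measure.QuasiMeasurePreserving (fun x : Fin n → ℝ => expMatrix C t *ᵥ x) := by
  have hu := isUnit_det_of_mul_transpose hC
  refine Measure.LinearMap.quasiMeasurePreserving volume (Matrix.toLin' (expMatrix C t)) ?_
  rw [LinearMap.det_toLin', expMatrix, Matrix.det_mul, Matrix.det_mul, Matrix.det_diagonal]
  refine mul_ne_zero (mul_ne_zero ?_ (Finset.prod_ne_zero_iff.2 fun j _ => Real.exp_ne_zero _))
    hu.ne_zero
  exact (Matrix.isUnit_nonsing_inv_det C hu).ne_zero

theorem measurable_expMatrix_mulVec {t : Ω → EuclideanSpace ℝ (Fin n)} (ht : Measurable t) :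
    Measurable fun p : Ω × (Fin n → ℝ) => expMatrix C (t p.1) *ᵥ p.2 := by
  have h1 : ∀ p : Ω × (Fin n → ℝ), expMatrix C (t p.1) *ᵥ p.2 =
      C⁻¹ *ᵥ fun j => Real.exp (t p.1 j) * (C *ᵥ p.2) j := by
    intro p
    rw [expMatrix, ← Matrix.mulVec_mulVec, ← Matrix.mulVec_mulVec]
    congr 1
    ext j
    rw [Matrix.mulVec_diagonal]
  simp only [h1]
  have h2 : Measurable fun v : Fin n → ℝ => C⁻¹ *ᵥ v := by fun_prop
  have h3 : Measurable fun v : Fin n → ℝ => C *ᵥ v := by fun_prop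
  refine h2.comp (measurable_pi_lambda _ fun j => ?_)
  have h4 : Measurable fun p : Ω × (Fin n → ℝ) => (C *ᵥ p.2) j :=
    (measurable_pi_apply j).comp (h3.comp measurable_snd)
  exact Measurable.mul (by fun_prop) h4

/-- The density with respect to `μ` of the operator in logarithmic coordinates. -/
noncomputable def logDensity (Φ : Ω → ℂ) (t : Ω → EuclideanSpace ℝ (Fin n)) (u : Ω) : ℂ :=
  Φ u * Real.exp (-(∑ j, t u j) / 2)

/-- The passage to logarithmic coordinates followed by the Fourier transform turns a Hausdorff
operator into multiplication by its symbol. -/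
theorem mellin_hausdorff [SigmaFinite μ] (hC : C * Cᵀ = 1) {Φ : Ω → ℂ}
    {t : Ω → EuclideanSpace ℝ (Fin n)} (ht : Measurable t) (hκ : Integrable (logDensity Φ t) μ)
    (T : Lp ℂ 2 (volume : Measure (Fin n → ℝ)) →L[ℂ] Lp ℂ 2 (volume : Measure (Fin n → ℝ)))
    (hT : ∀ f : Lp ℂ 2 (volume : Measure (Fin n → ℝ)),
      ∀ᵐ x, T f x = ∫ u, Φ u * f (expMatrix C (t u) *ᵥ x) ∂μ) :
    (mellinEquiv hC).conjStarAlgEquiv T = mulLp _ (memLp_translationSymbol hκ ht) := by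
  ext1 h'
  refine ext_inner_left ℂ fun k' => ?_
  obtain ⟨f, rfl⟩ := (mellinEquiv hC).surjective h'
  obtain ⟨k, rfl⟩ := (Lp.fourierTransformₗᵢ _ _).surjective k'
  rw [LinearIsometryEquiv.conjStarAlgEquiv_apply_apply, LinearIsometryEquiv.symm_apply_apply]
  change inner ℂ (Lp.fourierTransformₗᵢ _ _ k)
    (Lp.fourierTransformₗᵢ _ _ (orthantIsometry hC (T f))) = inner ℂ (Lp.fourierTransformₗᵢ _ _ k)
      (mulLp _ (memLp_translationSymbol hκ ht) (Lp.fourierTransformₗᵢ _ _ (orthantIsometry hC f)))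
  rw [LinearIsometryEquiv.inner_map_map]
  refine fourier_translationAverage hκ ht _ _ _ fun ε => ?_
  have hmp : MeasurePreserving (fun p : Ω × EuclideanSpace ℝ (Fin n) => (p.1, p.2 + t p.1))
      (μ.prod volume) (μ.prod volume) :=
    (MeasurePreserving.id μ).skew_product (g := fun u y => y + t u) (by fun_prop)
      (.of_forall fun u => map_add_right_eq_self volume (t u))
  have hq := (Measure.quasiMeasurePreserving_snd (μ := μ)
    (ν := (volume : Measure (EuclideanSpace ℝ (Fin n))))).comp
      (hmp.comp (Measure.measurePreserving_swap (μ := volume) (ν := μ))).quasiMeasurePreserving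
  have hae := Measure.ae_ae_of_ae_prod (hq.ae_eq_comp (coeFn_orthantIsometry hC f))
  filter_upwards [coeFn_orthantIsometry hC (T f), hae,
    (quasiMeasurePreserving_orthantMap hC ε).ae (hT f)] with y h1 h2 h3
  simp only [h1, orthantCoord, h3, ← integral_const_mul]
  refine integral_congr_ae ?_
  filter_upwards [h2] with u hu
  simp only [Function.comp_apply, Prod.swap_prod_mk] at hu
  simp only [hu, orthantCoord]
  rw [expMatrix_mulVec_orthantMap hC, logDensity, mul_left_comm, mul_assoc,
    ← mul_assoc (Complex.ofReal _) (Complex.ofReal _), ← Complex.ofReal_mul, ← Real.exp_add]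
  congr 4
  simp only [PiLp.add_apply, Finset.sum_add_distrib]
  ring

/-- Every `L²` function is a difference of two `L²` functions without zeros. -/
theorem exists_ne_zero_sub_eq {α : Type*} [MeasurableSpace α] (ν : Measure α) [SigmaFinite ν]
    (f : Lp ℂ 2 ν) :
    ∃ g h : Lp ℂ 2 ν, f = g - h ∧ (∀ᵐ x ∂ν, g x ≠ 0) ∧ ∀ᵐ x ∂ν, h x ≠ 0 := by
  obtain ⟨p, hp, hpm, hpi⟩ := exists_pos_lintegral_lt_of_sigmaFinite ν one_ne_zero
  have hp2 : MemLp (fun x => Real.sqrt (p x)) 2 ν := by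
    have hm : Measurable fun x => Real.sqrt (p x) := by fun_prop
    rw [memLp_two_iff_integrable_sq hm.aestronglyMeasurable]
    simp only [Real.sq_sqrt (NNReal.coe_nonneg _)]
    refine ⟨by fun_prop, ?_⟩
    rw [hasFiniteIntegral_iff_enorm]
    refine lt_of_le_of_lt (lintegral_mono fun x => ?_) (hpi.trans ENNReal.one_lt_top)
    simp
  have hw : MemLp (fun x => ((2 * (‖f x‖ + Real.sqrt (p x)) : ℝ) : ℂ)) 2 ν :=
    (((Lp.memLp f).norm.add hp2).const_mul 2).ofReal
  have hpos : ∀ x, 0 < Real.sqrt (p x) := fun x => Real.sqrt_pos.2 (hp x)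
  refine ⟨f + hw.toLp _, hw.toLp _, (add_sub_cancel_right _ _).symm, ?_, ?_⟩
  · filter_upwards [Lp.coeFn_add f (hw.toLp _), hw.coeFn_toLp] with x h1 h2 h0
    rw [h1, Pi.add_apply, h2] at h0
    have h3 := congrArg norm (eq_neg_of_add_eq_zero_left h0)
    rw [norm_neg, Complex.norm_real, Real.norm_eq_abs,
      abs_of_nonneg (by have := (hpos x).le; positivity)] at h3
    linarith [hpos x, norm_nonneg (f x)]
  · filter_upwards [hw.coeFn_toLp] with x h2 h0
    rw [h2, Complex.ofReal_eq_zero] at h0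
    linarith [hpos x, norm_nonneg (f x)]

theorem ae_integral_eq_zero_of_not_aestronglyMeasurable {X : Type*} [MeasurableSpace X]
    {ν : Measure X} [SFinite μ] [SFinite ν] {Φ : Ω → ℂ} (hΦ : ¬ AEStronglyMeasurable Φ μ)
    {g : Ω × X → ℂ} (hg : Measurable g) (h0 : ∀ᵐ u ∂μ, ∀ᵐ x ∂ν, g (u, x) ≠ 0) :
    ∀ᵐ x ∂ν, ∫ u, Φ u * g (u, x) ∂μ = 0 := by
  have hset : MeasurableSet {p : Ω × X | g p ≠ 0} := hg (measurableSet_singleton 0).compl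
  have h1 := (Measure.ae_ae_comm (p := fun u x => g (u, x) ≠ 0) hset).1 h0
  filter_upwards [h1] with x h3
  refine integral_undef fun hi => hΦ ?_
  have hx : Measurable fun u => g (u, x) := hg.comp (measurable_id.prodMk measurable_const)
  refine (hi.1.mul hx.inv.aestronglyMeasurable).congr ?_
  filter_upwards [h3] with u hu
  simp [hu]

/-- If `Φ` is not measurable, then the defining integral is degenerate and the operator is zero. -/
theorem hausdorff_eq_zero [SigmaFinite μ] (hC : C * Cᵀ = 1) {Φ : Ω → ℂ}
    {t : Ω → EuclideanSpace ℝ (Fin n)} (ht : Measurable t) (hΦ : ¬ AEStronglyMeasurable Φ μ)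
    (T : Lp ℂ 2 (volume : Measure (Fin n → ℝ)) →L[ℂ] Lp ℂ 2 (volume : Measure (Fin n → ℝ)))
    (hT : ∀ f : Lp ℂ 2 (volume : Measure (Fin n → ℝ)),
      ∀ᵐ x, T f x = ∫ u, Φ u * f (expMatrix C (t u) *ᵥ x) ∂μ) : T = 0 := by
  have key : ∀ f : Lp ℂ 2 (volume : Measure (Fin n → ℝ)), (∀ᵐ x, f x ≠ 0) → T f = 0 := by
    intro f hf
    have hfm : Measurable f := (Lp.stronglyMeasurable f).measurable
    have h1 := ae_integral_eq_zero_of_not_aestronglyMeasurable (ν := volume) hΦ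
      (hfm.comp (measurable_expMatrix_mulVec (C := C) ht))
      (.of_forall fun u => (quasiMeasurePreserving_expMatrix hC (t u)).ae hf)
    refine Lp.ext ?_
    filter_upwards [hT f, h1, Lp.coeFn_zero ℂ 2 (volume : Measure (Fin n → ℝ))] with x h2 h3 h4
    rw [h2, h4]
    exact h3
  ext1 f
  obtain ⟨g, h, rfl, hg, hh⟩ := exists_ne_zero_sub_eq volume f
  rw [map_sub, key g hg, key h hh, sub_zero, _root_.zero_apply]

theorem translationSymbol_eq_zero {E : Type*} [NormedAddCommGroup E] [InnerProductSpace ℝ E]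
    [MeasurableSpace E] [BorelSpace E] [SecondCountableTopology E] {κ : Ω → ℂ} {t : Ω → E}
    (ht : Measurable t) (hκ : ¬ AEStronglyMeasurable κ μ) : translationSymbol μ κ t = 0 := by
  ext s
  refine integral_undef fun hi => hκ ?_
  have hm : AEStronglyMeasurable (fun u => (Real.fourierChar ⟪t u, s⟫ : ℂ)⁻¹) μ := by
    have h1 : Measurable fun u => ⟪t u, s⟫ := by fun_prop
    have h2 : Continuous fun x : ℝ => (Real.fourierChar x : ℂ) := by fun_prop
    exact (h2.measurable.comp h1).inv.aestronglyMeasurable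
  refine (hi.1.mul hm).congr (.of_forall fun u => ?_)
  simp

/-- A Hausdorff operator is unitarily equivalent to multiplication by its continuous symbol. -/
theorem exists_conj_hausdorff_eq_mulLp [SigmaFinite μ] (hC : C * Cᵀ = 1) {Φ : Ω → ℂ}
    {t : Ω → EuclideanSpace ℝ (Fin n)} (ht : Measurable t)
    (hκ : Integrable (fun u => ‖logDensity Φ t u‖) μ)
    (T : Lp ℂ 2 (volume : Measure (Fin n → ℝ)) →L[ℂ] Lp ℂ 2 (volume : Measure (Fin n → ℝ)))
    (hT : ∀ f : Lp ℂ 2 (volume : Measure (Fin n → ℝ)),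
      ∀ᵐ x, T f x = ∫ u, Φ u * f (expMatrix C (t u) *ᵥ x) ∂μ) :
    Continuous (translationSymbol μ (logDensity Φ t) t) ∧
      ∃ hb : MemLp (translationSymbol μ (logDensity Φ t) t) ∞ volume,
        (mellinEquiv hC).conjStarAlgEquiv T = mulLp _ hb := by
  by_cases hm : AEStronglyMeasurable (logDensity Φ t) μ
  · have hκ' := (integrable_norm_iff hm).1 hκ
    exact ⟨continuous_translationSymbol hκ' ht, memLp_translationSymbol hκ' ht,
      mellin_hausdorff hC ht hκ' T hT⟩
  · have h0 := translationSymbol_eq_zero ht hm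
    have hΦ : ¬ AEStronglyMeasurable Φ μ := fun h => hm (h.mul (by fun_prop))
    rw [h0, hausdorff_eq_zero hC ht hΦ T hT, map_zero]
    refine ⟨continuous_zero, MemLp.zero, ?_⟩
    ext1 f
    refine Lp.ext ?_
    filter_upwards [coeFn_mulLp MemLp.zero f, Lp.coeFn_zero (EuclideanSpace ℂ (Fin n → Bool)) 2
      (volume : Measure (EuclideanSpace ℝ (Fin n)))] with x h1 h2
    rw [h1, _root_.zero_apply, h2]
    simp

/-- A closed condition on a continuous function holds everywhere as soon as it holds almost
everywhere. -/
theorem ae_iff_forall_of_isClosed {X Y : Type*} [TopologicalSpace X] [MeasurableSpace X]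
    [TopologicalSpace Y] {ν : Measure X} [ν.IsOpenPosMeasure] {b : X → Y} (hb : Continuous b)
    {S : Set Y} (hS : IsClosed S) : (∀ᵐ x ∂ν, b x ∈ S) ↔ ∀ x, b x ∈ S := by
  refine ⟨fun h x => ?_, .of_forall⟩
  have hd : Dense {x | b x ∈ S} := Measure.dense_of_ae h
  have : closure {x | b x ∈ S} = {x | b x ∈ S} := (hS.preimage hb).closure_eq
  exact this.subset (hd x)

end HausdorffOperator

theorem prod_cpow_eq_exp_mul_fourierChar {n : ℕ} (a : Fin n → ℝ) (ha : ∀ j, 0 < a j)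
    (s : Fin n → ℝ) :
    ∏ j, (a j : ℂ) ^ (-(1 / 2 : ℂ) - Complex.I * (s j : ℂ)) =
      (Real.exp (-(∑ j, Real.log (a j)) / 2) : ℂ) *
        Real.fourierChar (inner ℝ (WithLp.toLp 2 fun j => Real.log (a j))
          (-(2 * Real.pi)⁻¹ • WithLp.toLp 2 s : EuclideanSpace ℝ (Fin n))) := by
  have h1 : ∀ j, (a j : ℂ) ^ (-(1 / 2 : ℂ) - Complex.I * (s j : ℂ)) =
      Complex.exp (Real.log (a j) * (-(1 / 2 : ℂ) - Complex.I * (s j : ℂ))) := fun j => by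
    rw [Complex.cpow_def_of_ne_zero (by exact_mod_cast (ha j).ne'), Complex.ofReal_log (ha j).le]
  rw [Finset.prod_congr rfl fun j _ => h1 j, ← Complex.exp_sum, Real.fourierChar_apply,
    Complex.ofReal_exp, ← Complex.exp_add, inner_smul_right, PiLp.inner_apply]
  congr 1
  have h2 : (2 * Real.pi : ℝ) * (-(2 * Real.pi)⁻¹) = -1 := by
    field_simp
  rw [← mul_assoc, h2]
  push_cast
  simp only [RCLike.inner_apply, conj_trivial, neg_div, Finset.sum_div, ← Finset.sum_neg_distrib,
    neg_mul, one_mul, Finset.sum_mul, Complex.ofReal_mul,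
    ← Finset.sum_add_distrib]
  refine Finset.sum_congr rfl fun j _ => ?_
  ring

theorem prod_rpow_neg_half_eq_exp {n : ℕ} (a : Fin n → ℝ) (ha : ∀ j, 0 < a j) :
    (∏ j, a j) ^ (-((1 : ℝ) / 2)) = Real.exp (-(∑ j, Real.log (a j)) / 2) := by
  rw [Real.rpow_def_of_pos (Finset.prod_pos fun j _ => ha j),
    Real.log_prod fun j _ => (ha j).ne']
  congr 1
  ring

/-- A normal Hausdorff operator on `L²(ℝⁿ)` is self-adjoint (positive, unitary) iff its symbol
is real-valued (respectively nonnegative, of modulus one). -/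
theorem hausdorff_selfAdjoint_positive_unitary_iff {Ω : Type*} [MeasurableSpace Ω]
    (μ : Measure Ω) [SigmaFinite μ] (n : ℕ)
    (Φ : Ω → ℂ) (A : Ω → Matrix (Fin n) (Fin n) ℝ)
    (C : Matrix (Fin n) (Fin n) ℝ) (hC : C * Cᵀ = 1)
    (a : Fin n → Ω → ℝ) (ha : ∀ j, Measurable (a j))
    (hapos : ∀ᵐ u ∂μ, Φ u ≠ 0 → ∀ j, 0 < a j u)
    (hdiag : ∀ᵐ u ∂μ, Φ u ≠ 0 → A u = C⁻¹ * Matrix.diagonal (fun j => a j u) * C)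
    (hint : Integrable (fun u => ‖Φ u‖ * (∏ j, a j u) ^ (-((1 : ℝ) / 2))) μ)
    (T : Lp ℂ 2 (volume : Measure (Fin n → ℝ)) →L[ℂ] Lp ℂ 2 (volume : Measure (Fin n → ℝ)))
    (hT : ∀ f : Lp ℂ 2 (volume : Measure (Fin n → ℝ)),
      ∀ᵐ x : Fin n → ℝ ∂volume, T f x = ∫ u, Φ u * f ((A u).mulVec x) ∂μ)
    (φ : (Fin n → ℝ) → ℂ)
    (hφ : ∀ s : Fin n → ℝ,
      φ s = ∫ u, Φ u * ∏ j, (a j u : ℂ) ^ (-(1 / 2 : ℂ) - Complex.I * (s j : ℂ)) ∂μ) :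
    (IsSelfAdjoint T ↔ ∀ s : Fin n → ℝ, (φ s).im = 0) ∧
    (T.IsPositive ↔ ∀ s : Fin n → ℝ, 0 ≤ (φ s).re ∧ (φ s).im = 0) ∧
    ((ContinuousLinearMap.adjoint T ∘L T = 1 ∧ T ∘L ContinuousLinearMap.adjoint T = 1) ↔
      ∀ s : Fin n → ℝ, ‖φ s‖ = 1) := by
  set t : Ω → EuclideanSpace ℝ (Fin n) := fun u => WithLp.toLp 2 fun j => Real.log (a j u)
    with ht_def
  have ht : Measurable t :=
    (WithLp.measurable_toLp 2 _).comp (measurable_pi_lambda _ fun j => (ha j).log)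
  have hκ : Integrable (fun u => ‖logDensity Φ t u‖) μ := by
    refine hint.congr ?_
    filter_upwards [hapos] with u hu
    by_cases h0 : Φ u = 0
    · simp [logDensity, h0]
    · rw [prod_rpow_neg_half_eq_exp _ (hu h0), logDensity, norm_mul, Complex.norm_real,
        Real.norm_eq_abs, Real.abs_exp]
  have hT' : ∀ f : Lp ℂ 2 (volume : Measure (Fin n → ℝ)),
      ∀ᵐ x, T f x = ∫ u, Φ u * f (expMatrix C (t u) *ᵥ x) ∂μ := by
    intro f
    filter_upwards [hT f] with x hx
    rw [hx]
    refine integral_congr_ae ?_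
    filter_upwards [hapos, hdiag] with u h1 h2
    by_cases h0 : Φ u = 0
    · simp [h0]
    · have h3 : A u = expMatrix C (t u) := by
        simp only [h2 h0, expMatrix, ht_def, Real.exp_log (h1 h0 _)]
      simp only [h3]
  have hφ' : ∀ s, φ s = translationSymbol μ (logDensity Φ t) t
      (-(2 * Real.pi)⁻¹ • WithLp.toLp 2 s) := by
    intro s
    rw [hφ, translationSymbol]
    refine integral_congr_ae ?_
    filter_upwards [hapos] with u h1
    by_cases h0 : Φ u = 0
    · simp [logDensity, h0]
    · simp only [prod_cpow_eq_exp_mul_fourierChar _ (h1 h0), logDensity, ht_def, mul_assoc]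
  have hforall : ∀ p : ℂ → Prop, (∀ x, p (translationSymbol μ (logDensity Φ t) t x)) ↔
      ∀ s, p (φ s) := by
    refine fun p => ⟨fun h s => hφ' s ▸ h _, fun h x => ?_⟩
    have hx := h (-(2 * Real.pi) • x.ofLp)
    rwa [hφ', WithLp.toLp_smul, WithLp.toLp_ofLp, smul_smul, neg_mul_neg,
      inv_mul_cancel₀ (by positivity), one_smul] at hx
  obtain ⟨hcont, hb, hW⟩ := exists_conj_hausdorff_eq_mulLp hC ht hκ T hT'
  obtain ⟨h1, h2, h3⟩ := properties_conjStarAlgEquiv_iff _ hW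
  have him : IsClosed {z : ℂ | z.im = 0} := isClosed_eq Complex.continuous_im continuous_const
  refine ⟨?_, ?_, ?_⟩
  · rw [h1, isSelfAdjoint_mulLp_iff, ← hforall fun z => z.im = 0]
    exact ae_iff_forall_of_isClosed hcont him
  · rw [h2, isPositive_mulLp_iff, ← hforall fun z => 0 ≤ z.re ∧ z.im = 0]
    exact ae_iff_forall_of_isClosed hcont
      ((isClosed_le continuous_const Complex.continuous_re).inter him)
  · refine h3.trans ?_
    rw [mulLp_isometry_iff, ← hforall fun z => ‖z‖ = 1]
    exact ae_iff_forall_of_isClosed hcont (isClosed_eq continuous_norm continuous_const)
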